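/- Let T, T_n be closed operators on a Hilbert space, let z ∈ ℂ be in the resolvent sets of T and of all T_n, and suppose ‖(zI - T_n)^{-1} - (zI - T)^{-1}‖ → 0. Then limsup_{n→∞} σ(T_n) ⊆ σ(T), where limsup_{n→∞} σ(T_n) = ∩_{m∈ℕ} closure(∪_{n≥m} σ(T_n)). -/

import Mathlib

open Filter Metric Set Topology

/-- `S` is a bounded (everywhere-defined) inverse of the operator `zI - T`, where `T` is a
possibly unbounded operator given as a `LinearPMap`. -/
def IsResolventOf {H : Type*} [NormedAddCommGroup H] [InnerProductSpace ℂ H]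
    (S : H →L[ℂ] H) (T : H →ₗ.[ℂ] H) (z : ℂ) : Prop :=
  (∀ x : T.domain, S (z • (x : H) - T x) = x) ∧
  (∀ y : H, ∃ hy : S y ∈ T.domain, z • (S y) - T ⟨S y, hy⟩ = y)

/-- The spectrum of a possibly unbounded operator `T`: the set of `λ` such that `λI - T` has
no bounded (everywhere-defined) inverse. -/
def SpecSet {H : Type*} [NormedAddCommGroup H] [InnerProductSpace ℂ H]
    (T : H →ₗ.[ℂ] H) : Set ℂ :=
  {lam : ℂ | ¬ ∃ S : H →L[ℂ] H, IsResolventOf S T lam}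

/-- The first resolvent identity, in product form. -/
theorem IsResolventOf.one_add_smul_mul_one_add_smul {H : Type*} [NormedAddCommGroup H]
    [InnerProductSpace ℂ H] {T : H →ₗ.[ℂ] H} {S R : H →L[ℂ] H} {z w : ℂ}
    (hS : IsResolventOf S T z) (hR : IsResolventOf R T w) :
    (1 + (w - z) • S) * (1 + (z - w) • R) = 1 := by
  ext y
  obtain ⟨hy, hRy⟩ := hR.2 y
  have hshift : y + (z - w) • R y = z • R y - T ⟨R y, hy⟩ := by
    nth_rewrite 1 [← hRy]
    module
  have hSy : S (y + (z - w) • R y) = R y := by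
    rw [hshift]
    exact hS.1 ⟨R y, hy⟩
  change (y + (z - w) • R y) + (w - z) • S (y + (z - w) • R y) = y
  rw [hSy]
  module

/-- Given the resolvent `S` of `T` at `z`, a point `w` is a resolvent point of `T` exactly when
`1 + (w - z) S` is invertible. -/
theorem IsResolventOf.notMem_specSet_iff {H : Type*} [NormedAddCommGroup H]
    [InnerProductSpace ℂ H] {T : H →ₗ.[ℂ] H} {S : H →L[ℂ] H} {z : ℂ}
    (hS : IsResolventOf S T z) (w : ℂ) :
    w ∉ SpecSet T ↔ IsUnit (1 + (w - z) • S) := by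
  rw [SpecSet, mem_ofPred_eq, not_not]
  constructor
  · rintro ⟨R, hR⟩
    exact ⟨⟨_, _, hS.one_add_smul_mul_one_add_smul hR, hR.one_add_smul_mul_one_add_smul hS⟩, rfl⟩
  · intro hU
    obtain ⟨V, hUV, hVU⟩ := isUnit_iff_exists.mp hU
    refine ⟨S * V, fun x => ?_, fun y => ?_⟩
    · have hx : w • (x : H) - T x = (1 + (w - z) • S) (z • (x : H) - T x) := by
        change _ = (z • (x : H) - T x) + (w - z) • S (z • (x : H) - T x)
        rw [hS.1 x]
        module
      have hV : V (w • (x : H) - T x) = z • (x : H) - T x := by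
        rw [hx]
        exact DFunLike.congr_fun hVU _
      change S (V (w • (x : H) - T x)) = x
      rw [hV, hS.1 x]
    · obtain ⟨hy, hVy⟩ := hS.2 (V y)
      refine ⟨hy, ?_⟩
      have hUVy : V y + (w - z) • S (V y) = y := DFunLike.congr_fun hUV y
      change w • S (V y) - T ⟨S (V y), hy⟩ = y
      refine Eq.trans ?_ hUVy
      nth_rewrite 3 [← hVy]
      module

/-- Theorem 4.7: if `T`, `Tₙ` are closed, densely defined operators, `z` is a common resolvent
point, and `‖(zI - Tₙ)⁻¹ - (zI - T)⁻¹‖ → 0` (norm resolvent convergence), then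
`limsup σ(Tₙ) = ∩_m closure(∪_{n ≥ m} σ(Tₙ)) ⊆ σ(T)`. -/
theorem limsup_spectrum_subset_of_norm_resolvent_convergence
    {H : Type*} [NormedAddCommGroup H] [InnerProductSpace ℂ H] [CompleteSpace H]
    (T : H →ₗ.[ℂ] H) (Tn : ℕ → H →ₗ.[ℂ] H)
    (hTc : T.IsClosed) (hTnc : ∀ n, (Tn n).IsClosed)
    (hTd : Dense (T.domain : Set H)) (hTnd : ∀ n, Dense ((Tn n).domain : Set H))
    (z : ℂ) (S : H →L[ℂ] H) (Sn : ℕ → H →L[ℂ] H)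
    (hS : IsResolventOf S T z) (hSn : ∀ n, IsResolventOf (Sn n) (Tn n) z)
    (hconv : Tendsto (fun n => ‖Sn n - S‖) atTop (𝓝 0)) :
    (⋂ m : ℕ, closure (⋃ n : ℕ, ⋃ _ : m ≤ n, SpecSet (Tn n))) ⊆ SpecSet T := by
  intro w hw
  by_contra hwT
  have hSn_tendsto : Tendsto Sn atTop (𝓝 S) := tendsto_iff_norm_sub_tendsto_zero.mpr hconv
  have htendsto : Tendsto (fun p : ℕ × ℂ => 1 + (p.2 - z) • Sn p.1) (atTop ×ˢ 𝓝 w)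
      (𝓝 (1 + (w - z) • S)) :=
    tendsto_const_nhds.add
      ((tendsto_snd.sub tendsto_const_nhds).smul (hSn_tendsto.comp tendsto_fst))
  have hunits : ∀ᶠ p : ℕ × ℂ in atTop ×ˢ 𝓝 w, IsUnit (1 + (p.2 - z) • Sn p.1) :=
    htendsto.eventually (Units.isOpen.mem_nhds ((hS.notMem_specSet_iff w).mp hwT))
  obtain ⟨P, hP, Q, hQ, hPQ⟩ := eventually_prod_iff.mp hunits
  obtain ⟨m, hm⟩ := eventually_atTop.mp hP
  obtain ⟨v, hvQ, hv⟩ := mem_closure_iff_nhds.mp (mem_iInter.mp hw m) _ hQ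
  simp only [mem_iUnion] at hv
  obtain ⟨n, hmn, hvn⟩ := hv
  exact ((hSn n).notMem_specSet_iff v).mpr (hPQ (hm n hmn) hvQ) hvn
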